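/- arXiv:2305.13185 — 2 statements merged into one kernel-verified Lean document; each statement's English description precedes it below -/
import Mathlib

section
/- Let d ≥ 1, S a set, φ : S → ℝ^d, f : S → (0,∞), C ⊆ S a finite set, and ρ a probability distribution on S supported on C, such that the weighted design matrix G_f = ∑_{y ∈ C} ρ(y) φ(y)φ(y)ᵀ / f(y)² is invertible. Then for every s ∈ S, ( ∑_{y ∈ C} ρ(y) · | φ(s)ᵀ G_f⁻¹ φ(y) / f(y) | )² ≤ φ(s)ᵀ G_f⁻¹ φ(s). -/
open Matrix

theorem dotProduct_sum_smul_vecMulVec_mulVec {ι n : Type*} [Fintype n] (C : Finset ι)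
    (w : ι → ℝ) (φ : ι → n → ℝ) (x : n → ℝ) :
    x ⬝ᵥ ((∑ y ∈ C, w y • vecMulVec (φ y) (φ y)) *ᵥ x) = ∑ y ∈ C, w y * (x ⬝ᵥ φ y) ^ 2 := by
  rw [sum_mulVec, dotProduct_sum]
  refine Finset.sum_congr rfl fun y _ => ?_
  rw [smul_mulVec, vecMulVec_mulVec, dotProduct_smul, dotProduct_smul, dotProduct_comm (φ y) x]
  simp only [smul_eq_mul, MulOpposite.smul_eq_mul_unop, MulOpposite.unop_op]
  ring

theorem isSymm_sum_smul_vecMulVec {ι n : Type*} (C : Finset ι) (w : ι → ℝ) (φ : ι → n → ℝ) :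
    (∑ y ∈ C, w y • vecMulVec (φ y) (φ y)).IsSymm := by
  simp [IsSymm, transpose_sum, transpose_smul, transpose_vecMulVec]

/-- Key intermediate step of the weighted Kiefer–Wolfowitz bound (Appendix G):
`(∑_{y∈C} ρ(y) |φ(s)ᵀ G_f⁻¹ φ(y)/f(y)|)² ≤ φ(s)ᵀ G_f⁻¹ φ(s)`. -/
theorem weighted_kw_intermediate
    (d : ℕ) (hd : 1 ≤ d) {S : Type*} (φ : S → Fin d → ℝ) (f : S → ℝ)
    (hf : ∀ s, 0 < f s)
    (C : Finset S) (ρ : S → ℝ)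
    (hρnn : ∀ y ∈ C, 0 ≤ ρ y) (hρ1 : ∑ y ∈ C, ρ y = 1)
    (G : Matrix (Fin d) (Fin d) ℝ)
    (hG : G = ∑ y ∈ C, (ρ y / f y ^ 2) • vecMulVec (φ y) (φ y))
    (hGunit : IsUnit G) :
    ∀ s : S,
      (∑ y ∈ C, ρ y * |φ s ⬝ᵥ (G⁻¹ *ᵥ φ y) / f y|) ^ 2 ≤ φ s ⬝ᵥ (G⁻¹ *ᵥ φ s) := by
  intro s
  have hsymm : G⁻¹ᵀ = G⁻¹ := by
    rw [transpose_nonsing_inv, hG, (isSymm_sum_smul_vecMulVec C _ φ).eq]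
  have hmove (y : S) : φ s ⬝ᵥ (G⁻¹ *ᵥ φ y) = (G⁻¹ *ᵥ φ s) ⬝ᵥ φ y := by
    rw [dotProduct_mulVec, ← mulVec_transpose, hsymm]
  have hsolve : G *ᵥ (G⁻¹ *ᵥ φ s) = φ s := by
    rw [mulVec_mulVec, mul_nonsing_inv G ((isUnit_iff_isUnit_det G).1 hGunit), one_mulVec]
  calc (∑ y ∈ C, ρ y * |φ s ⬝ᵥ (G⁻¹ *ᵥ φ y) / f y|) ^ 2
      ≤ ∑ y ∈ C, ρ y * |φ s ⬝ᵥ (G⁻¹ *ᵥ φ y) / f y| ^ 2 :=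
        Real.pow_arith_mean_le_arith_mean_pow C ρ _ hρnn hρ1 (fun _ _ => abs_nonneg _) 2
    _ = ∑ y ∈ C, ρ y / f y ^ 2 * ((G⁻¹ *ᵥ φ s) ⬝ᵥ φ y) ^ 2 := by
        refine Finset.sum_congr rfl fun y _ => ?_
        rw [sq_abs, hmove]
        ring
    _ = (G⁻¹ *ᵥ φ s) ⬝ᵥ (G *ᵥ (G⁻¹ *ᵥ φ s)) := by
        rw [← dotProduct_sum_smul_vecMulVec_mulVec, ← hG]
    _ = φ s ⬝ᵥ (G⁻¹ *ᵥ φ s) := by rw [hsolve, dotProduct_comm]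
end

section
/- Under the MDVI recursion with per-iteration errors described in the context, for every k ∈ {1,…,K}: v_{π'_{k−1}} + ∑_{j=0}^{k−1} γ^j π_{k−1} P_{k−1−j}^{k−2} ε̂_{k−j} − γ^k H · 1 ≤ v_k ≤ v_{π'_k} + ∑_{j=0}^{k−1} γ^j π_k P_{k−j}^{k−1} ε̂_{k−j} + γ^k H · 1 pointwise on X, where v_{π'_0} := v_{π_0}. -/
open Finset

noncomputable section

/-- `(Pq v)(x,a) = ∑_y P(y|x,a) v(y)`, the operator `P : F_v → F_q`. -/
def appP {X A : Type*} [Fintype X] (P : X → A → X → ℝ) (v : X → ℝ) : X → A → ℝ :=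
  fun x a => ∑ y, P x a y * v y

/-- `(π q)(x) = ∑_a π(a|x) q(x,a)`, the operator `π : F_q → F_v`. -/
def appPol {X A : Type*} [Fintype A] (pol : X → A → ℝ) (q : X → A → ℝ) : X → ℝ :=
  fun x => ∑ a, pol x a * q x a

/-- `P_π q = P (π q)`, the operator `P_π : F_q → F_q`. -/
def Ppol {X A : Type*} [Fintype X] [Fintype A] (P : X → A → X → ℝ) (pol : X → A → ℝ)
    (q : X → A → ℝ) : X → A → ℝ :=
  appP P (appPol pol q)

/-- Bellman operator `T_π q = r + γ P_π q`. -/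
def bellmanOp {X A : Type*} [Fintype X] [Fintype A] (γ : ℝ) (r : X → A → ℝ)
    (P : X → A → X → ℝ) (pol : X → A → ℝ) (q : X → A → ℝ) : X → A → ℝ :=
  fun x a => r x a + γ * Ppol P pol q x a

/-- `PpolProdN P πs i n = P_{π_i} P_{π_{i−1}} ⋯ P_{π_{i−n+1}}` (`n` factors; the identity
for `n = 0`), so that for `i ≥ j` the paper's `P_j^i` is `PpolProdN P πs i (i + 1 − j)`. -/
def PpolProdN {X A : Type*} [Fintype X] [Fintype A] (P : X → A → X → ℝ)
    (πs : ℕ → X → A → ℝ) (i n : ℕ) (q : X → A → ℝ) : X → A → ℝ :=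
  (((List.range n).map (fun t => Ppol P (πs (i - t)))).foldr (· ∘ ·) id) q

/-- `bellmanComp γ r P πs k = T_{π_{k−1}} ∘ ⋯ ∘ T_{π_1}` (the identity for `k ≤ 1`), so that
`v_{π'_k} = π_k (bellmanComp γ r P πs k q_{π_0})`; in particular `v_{π'_0} = π_0 q_{π_0} = v_{π_0}`. -/
def bellmanComp {X A : Type*} [Fintype X] [Fintype A] (γ : ℝ) (r : X → A → ℝ)
    (P : X → A → X → ℝ) (πs : ℕ → X → A → ℝ) (k : ℕ) (q : X → A → ℝ) : X → A → ℝ :=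
  (((List.range (k - 1)).map (fun t => bellmanOp γ r P (πs (k - 1 - t)))).foldr (· ∘ ·) id) q

/-- `π` is a policy: `π(·|x)` is a probability distribution over actions for each state. -/
def IsPolicy {X A : Type*} [Fintype A] (pol : X → A → ℝ) : Prop :=
  (∀ x a, 0 ≤ pol x a) ∧ ∀ x, ∑ a, pol x a = 1

/-- `π` is greedy with respect to `s`: `π(·|x)` is supported on `argmax_a s(x,a)`. -/
def IsGreedy {X A : Type*} (pol : X → A → ℝ) (s : X → A → ℝ) : Prop :=
  ∀ x a, pol x a ≠ 0 → ∀ b, s x b ≤ s x a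

end

section Operators

variable {X A : Type*}

theorem appPol_mono [Fintype A] {pol : X → A → ℝ} (hpol : IsPolicy pol) {q q' : X → A → ℝ}
    {x : X} (h : ∀ a, q x a ≤ q' x a) : appPol pol q x ≤ appPol pol q' x :=
  sum_le_sum fun a _ => mul_le_mul_of_nonneg_left (h a) (hpol.1 x a)

theorem appPol_const [Fintype A] {pol : X → A → ℝ} (hpol : IsPolicy pol) {q : X → A → ℝ}
    {x : X} {c : ℝ} (h : ∀ a, q x a = c) : appPol pol q x = c := by
  simp only [appPol, h, ← sum_mul, hpol.2, one_mul]

theorem appPol_add [Fintype A] (pol q q' : X → A → ℝ) (x : X) :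
    appPol pol (fun x a => q x a + q' x a) x = appPol pol q x + appPol pol q' x := by
  simp only [appPol, mul_add, sum_add_distrib]

theorem appPol_const_mul [Fintype A] (pol q : X → A → ℝ) (c : ℝ) (x : X) :
    appPol pol (fun x a => c * q x a) x = c * appPol pol q x := by
  simp only [appPol, mul_sum]
  exact sum_congr rfl fun a _ => by ring

theorem appPol_sum [Fintype A] {ι : Type*} (t : Finset ι) (pol : X → A → ℝ)
    (f : ι → X → A → ℝ) (x : X) :
    appPol pol (fun x a => ∑ j ∈ t, f j x a) x = ∑ j ∈ t, appPol pol (f j) x := by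
  simp only [appPol, mul_sum]
  exact sum_comm

theorem appP_mono [Fintype X] {P : X → A → X → ℝ} (hP : ∀ x a y, 0 ≤ P x a y) {v v' : X → ℝ}
    (h : ∀ y, v y ≤ v' y) (x : X) (a : A) : appP P v x a ≤ appP P v' x a :=
  sum_le_sum fun y _ => mul_le_mul_of_nonneg_left (h y) (hP x a y)

theorem appP_add [Fintype X] (P : X → A → X → ℝ) (v v' : X → ℝ) (x : X) (a : A) :
    appP P (fun y => v y + v' y) x a = appP P v x a + appP P v' x a := by
  simp only [appP, mul_add, sum_add_distrib]

theorem appP_add_const [Fintype X] {P : X → A → X → ℝ} (hP : ∀ x a, ∑ y, P x a y = 1)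
    (v : X → ℝ) (c : ℝ) (x : X) (a : A) : appP P (fun y => v y + c) x a = appP P v x a + c := by
  simp only [appP, mul_add, sum_add_distrib, ← sum_mul, hP, one_mul]

theorem appP_const_mul [Fintype X] (P : X → A → X → ℝ) (c : ℝ) (v : X → ℝ) (x : X) (a : A) :
    appP P (fun y => c * v y) x a = c * appP P v x a := by
  simp only [appP, mul_sum]
  exact sum_congr rfl fun y _ => by ring

theorem appP_sum [Fintype X] {ι : Type*} (t : Finset ι) (P : X → A → X → ℝ)
    (f : ι → X → ℝ) (x : X) (a : A) :
    appP P (fun y => ∑ j ∈ t, f j y) x a = ∑ j ∈ t, appP P (f j) x a := by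
  simp only [appP, mul_sum]
  exact sum_comm

theorem PpolProdN_succ [Fintype X] [Fintype A] (P : X → A → X → ℝ) (πs : ℕ → X → A → ℝ)
    (i n : ℕ) (q : X → A → ℝ) :
    PpolProdN P πs i (n + 1) q = Ppol P (πs i) (PpolProdN P πs (i - 1) n q) := by
  simp [PpolProdN, List.range_succ_eq_map, Function.comp_def, Nat.sub_sub, Nat.add_comm]

theorem bellmanComp_succ [Fintype X] [Fintype A] (γ : ℝ) (r : X → A → ℝ)
    (P : X → A → X → ℝ) (πs : ℕ → X → A → ℝ) (k : ℕ) (q : X → A → ℝ) :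
    bellmanComp γ r P πs (k + 2) q
      = bellmanOp γ r P (πs (k + 1)) (bellmanComp γ r P πs (k + 1) q) := by
  simp [bellmanComp, List.range_succ_eq_map, Function.comp_def]

/-- On a fixed point of `T_{π_0}`, the recursion for `bellmanComp` holds from index `0` on. -/
theorem bellmanComp_eq_bellmanOp_pred [Fintype X] [Fintype A] {γ : ℝ} {r : X → A → ℝ}
    {P : X → A → X → ℝ} {πs : ℕ → X → A → ℝ} {q : X → A → ℝ}
    (hq : q = bellmanOp γ r P (πs 0) q) (m : ℕ) :
    bellmanComp γ r P πs m q
      = bellmanOp γ r P (πs (m - 1)) (bellmanComp γ r P πs (m - 1) q) := by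
  match m with
  | 0 => exact hq
  | 1 => exact hq
  | m + 2 => exact bellmanComp_succ γ r P πs m q

/-- The action-value function `T_{π_{m-1}} ⋯ T_{π_1} q` plus the discounted propagation of the
last `k` errors. -/
def propagatedQ [Fintype X] [Fintype A] (γ : ℝ) (r : X → A → ℝ) (P : X → A → X → ℝ)
    (πs : ℕ → X → A → ℝ) (eps : ℕ → X → A → ℝ) (q : X → A → ℝ) (m k : ℕ) : X → A → ℝ :=
  fun x a => bellmanComp γ r P πs m q x a
    + ∑ j ∈ range k, γ ^ j * PpolProdN P πs (m - 1) j (eps (k - j)) x a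

theorem appPol_propagatedQ [Fintype X] [Fintype A] (γ : ℝ) (r : X → A → ℝ) (P : X → A → X → ℝ)
    (πs : ℕ → X → A → ℝ) (eps : ℕ → X → A → ℝ) (pol q : X → A → ℝ) (m k : ℕ) (x : X) :
    appPol pol (propagatedQ γ r P πs eps q m k) x
      = appPol pol (bellmanComp γ r P πs m q) x
        + ∑ j ∈ range k, γ ^ j * appPol pol (PpolProdN P πs (m - 1) j (eps (k - j))) x := by
  unfold propagatedQ
  rw [appPol_add, appPol_sum]
  simp only [appPol_const_mul]

theorem propagatedQ_succ [Fintype X] [Fintype A] {γ : ℝ} {r : X → A → ℝ} {P : X → A → X → ℝ}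
    {πs : ℕ → X → A → ℝ} (eps : ℕ → X → A → ℝ) {q : X → A → ℝ}
    (hq : q = bellmanOp γ r P (πs 0) q) (m k : ℕ) (x : X) (a : A) :
    propagatedQ γ r P πs eps q m (k + 1) x a
      = r x a + γ * Ppol P (πs (m - 1)) (propagatedQ γ r P πs eps q (m - 1) k) x a
        + eps (k + 1) x a := by
  have hP : Ppol P (πs (m - 1)) (propagatedQ γ r P πs eps q (m - 1) k) x a
      = Ppol P (πs (m - 1)) (bellmanComp γ r P πs (m - 1) q) x a
        + ∑ j ∈ range k, γ ^ j * PpolProdN P πs (m - 1) (j + 1) (eps (k - j)) x a := by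
    simp only [PpolProdN_succ]
    unfold Ppol
    rw [funext (appPol_propagatedQ γ r P πs eps _ q (m - 1) k), appP_add, appP_sum]
    simp only [appP_const_mul]
  rw [hP, propagatedQ, bellmanComp_eq_bellmanOp_pred hq m, sum_range_succ']
  simp only [bellmanOp, Nat.add_sub_add_right, pow_zero, one_mul, Nat.sub_zero, mul_add, mul_sum,
    pow_succ']
  simp only [PpolProdN, List.range_zero, List.map_nil, List.foldr_nil, id, mul_assoc]
  ring

/-- A fixed point of `T_π` is bounded by the effective horizon. -/
theorem abs_le_of_eq_bellmanOp [Fintype X] [Fintype A] {γ : ℝ} (hγ0 : 0 ≤ γ) (hγ1 : γ < 1)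
    {r : X → A → ℝ} (hr : ∀ x a, |r x a| ≤ 1) {P : X → A → X → ℝ}
    (hPnn : ∀ x a y, 0 ≤ P x a y) (hPsum : ∀ x a, ∑ y, P x a y = 1) {pol : X → A → ℝ}
    (hpol : IsPolicy pol) {q : X → A → ℝ} (hq : q = bellmanOp γ r P pol q) (x : X) (a : A) :
    |q x a| ≤ (1 - γ)⁻¹ := by
  have : Nonempty (X × A) := ⟨(x, a)⟩
  obtain ⟨p, hp⟩ := Finite.exists_max fun p : X × A => |q p.1 p.2|
  set M := |q p.1 p.2|
  have hbound : ∀ y b, -M ≤ q y b ∧ q y b ≤ M := fun y b => abs_le.1 (hp (y, b))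
  have hpolq : ∀ y, -M ≤ appPol pol q y ∧ appPol pol q y ≤ M := fun y =>
    ⟨(appPol_const hpol (q := fun _ _ => -M) fun _ => rfl).symm.trans_le
      (appPol_mono hpol fun b => (hbound y b).1),
    (appPol_mono hpol fun b => (hbound y b).2).trans_eq
      (appPol_const hpol (q := fun _ _ => M) fun _ => rfl)⟩
  have hconst : ∀ c, appP P (fun _ => c) p.1 p.2 = c := fun c => by
    simp only [appP, ← sum_mul, hPsum, one_mul]
  have hPq : |Ppol P pol q p.1 p.2| ≤ M :=
    abs_le.2 ⟨(hconst (-M)).symm.trans_le (appP_mono hPnn (fun y => (hpolq y).1) _ _),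
      (appP_mono hPnn (fun y => (hpolq y).2) _ _).trans_eq (hconst M)⟩
  have hM : M ≤ 1 + γ * M := calc
    M = |r p.1 p.2 + γ * Ppol P pol q p.1 p.2| := congrArg abs (congrFun₂ hq p.1 p.2)
    _ ≤ |r p.1 p.2| + |γ * Ppol P pol q p.1 p.2| := abs_add_le _ _
    _ ≤ 1 + γ * M := by
      rw [abs_mul, abs_of_nonneg hγ0]
      exact add_le_add (hr _ _) (mul_le_mul_of_nonneg_left hPq hγ0)
  refine (hp (x, a)).trans ?_
  rw [← one_div, le_div_iff₀ (by linarith)]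
  linarith

theorem appPol_le_sup' [Fintype A] [Nonempty A] {pol : X → A → ℝ} (hpol : IsPolicy pol)
    (s : X → A → ℝ) (x : X) : appPol pol s x ≤ univ.sup' univ_nonempty (fun a => s x a) :=
  (appPol_mono hpol fun a => le_sup' (fun a => s x a) (mem_univ a)).trans_eq
    (appPol_const hpol (q := fun x _ => univ.sup' univ_nonempty (fun a => s x a)) fun _ => rfl)

theorem IsGreedy.appPol_eq_sup' [Fintype A] [Nonempty A] {pol s : X → A → ℝ}
    (hgreedy : IsGreedy pol s) (hpol : IsPolicy pol) (x : X) :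
    appPol pol s x = univ.sup' univ_nonempty (fun a => s x a) := by
  rw [← appPol_const hpol (x := x) (q := fun x _ => univ.sup' univ_nonempty (fun a => s x a))
    fun _ => rfl]
  refine sum_congr rfl fun a _ => ?_
  by_cases h : pol x a = 0
  · simp [h]
  · exact congrArg _ (le_antisymm (le_sup' (fun a => s x a) (mem_univ a))
      (sup'_le _ _ fun b _ => hgreedy x a h b))

/-- One step of the recursion: a bound on `v` propagates through `r + γ P v + e`. -/
theorem bellman_step_le [Fintype X] [Fintype A] {γ : ℝ} (hγ0 : 0 ≤ γ) {P : X → A → X → ℝ}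
    (hPnn : ∀ x a y, 0 ≤ P x a y) (hPsum : ∀ x a, ∑ y, P x a y = 1) {pol : X → A → ℝ}
    (hpol : IsPolicy pol) (r e : X → A → ℝ) {v v' : X → ℝ} {c : ℝ} (h : ∀ y, v y ≤ v' y + c)
    (x : X) :
    appPol pol (fun x a => r x a + γ * appP P v x a + e x a) x
      ≤ appPol pol (fun x a => r x a + γ * appP P v' x a + e x a) x + γ * c := by
  rw [← appPol_const hpol (x := x) (q := fun _ _ => γ * c) fun _ => rfl, ← appPol_add]
  refine appPol_mono hpol fun a => ?_
  have := mul_le_mul_of_nonneg_left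
    ((appP_mono hPnn h x a).trans_eq (appP_add_const hPsum v' c x a)) hγ0
  linarith

end Operators

/-- Intermediate value-error propagation for WLS-MDVI (Lemma H.4): under the MDVI recursion
with per-iteration errors `ε̂_k`, for every `1 ≤ k ≤ K`,
`v_{π'_{k−1}} + ∑_{j<k} γ^j π_{k−1} P_{k−1−j}^{k−2} ε̂_{k−j} − γ^k H
  ≤ v_k ≤ v_{π'_k} + ∑_{j<k} γ^j π_k P_{k−j}^{k−1} ε̂_{k−j} + γ^k H` pointwise. -/
theorem mdvi_value_error_propagation
    {X A : Type*} [Fintype X] [Fintype A] [Nonempty X] [Nonempty A]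
    (γ : ℝ) (hγ0 : 0 ≤ γ) (hγ1 : γ < 1)
    (H : ℝ) (hH : H = (1 - γ)⁻¹)
    (α : ℝ) (hα0 : 0 ≤ α) (hα1 : α < 1)
    (r : X → A → ℝ) (hr : ∀ x a, |r x a| ≤ 1)
    (P : X → A → X → ℝ)
    (hPnn : ∀ x a y, 0 ≤ P x a y) (hPsum : ∀ x a, ∑ y, P x a y = 1)
    (K : ℕ) (eps : ℕ → X → A → ℝ)
    (πs : ℕ → X → A → ℝ) (hπs : ∀ k ≤ K, IsPolicy (πs k))
    (qpi0 : X → A → ℝ) (hqpi0 : qpi0 = bellmanOp γ r P (πs 0) qpi0)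
    (v w : ℕ → X → ℝ) (s : ℕ → X → A → ℝ)
    (hs0 : s 0 = 0) (hw0 : w 0 = 0) (hv0 : v 0 = 0)
    (hs : ∀ k, 1 ≤ k → k ≤ K → ∀ x a,
      s k x a = α * s (k - 1) x a + r x a + γ * appP P (v (k - 1)) x a + eps k x a)
    (hw : ∀ k, 1 ≤ k → k ≤ K → ∀ x,
      w k x = univ.sup' univ_nonempty (fun a => s k x a))
    (hv : ∀ k, 1 ≤ k → k ≤ K → ∀ x, v k x = w k x - α * w (k - 1) x)
    (hgreedy : ∀ k, 1 ≤ k → k ≤ K → IsGreedy (πs k) (s k)) :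
    ∀ k, 1 ≤ k → k ≤ K → ∀ x,
      (appPol (πs (k - 1)) (bellmanComp γ r P πs (k - 1) qpi0) x
          + (∑ j ∈ range k, γ ^ j *
              appPol (πs (k - 1)) (PpolProdN P πs (k - 2) j (eps (k - j))) x)
          - γ ^ k * H ≤ v k x) ∧
      v k x ≤ appPol (πs k) (bellmanComp γ r P πs k qpi0) x
          + (∑ j ∈ range k, γ ^ j *
              appPol (πs k) (PpolProdN P πs (k - 1) j (eps (k - j))) x)
          + γ ^ k * H := by
  have hq0 : ∀ x, |appPol (πs 0) qpi0 x| ≤ H := fun x => by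
    have hpol := hπs 0 (Nat.zero_le K)
    have hb := fun a => abs_le.1 <|
      hH ▸ abs_le_of_eq_bellmanOp hγ0 hγ1 hr hPnn hPsum hpol hqpi0 x a
    exact abs_le.2 ⟨(appPol_const hpol (q := fun _ _ => -H) fun _ => rfl).symm.trans_le
        (appPol_mono hpol fun a => (hb a).1),
      (appPol_mono hpol fun a => (hb a).2).trans_eq
        (appPol_const hpol (q := fun _ _ => H) fun _ => rfl)⟩
  have hw_ge : ∀ k ≤ K, ∀ pol, IsPolicy pol → ∀ x, appPol pol (s k) x ≤ w k x := by
    intro k hk pol hpol x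
    rcases Nat.eq_zero_or_pos k with rfl | hpos
    · simp [hs0, hw0, appPol]
    · exact hw k hpos hk x ▸ appPol_le_sup' hpol (s k) x
  have hw_eq : ∀ k ≤ K, ∀ x, appPol (πs k) (s k) x = w k x := by
    intro k hk x
    rcases Nat.eq_zero_or_pos k with rfl | hpos
    · simp [hs0, hw0, appPol]
    · exact hw k hpos hk x ▸ (hgreedy k hpos hk).appPol_eq_sup' (hπs k hk) x
  have hs_pol : ∀ k, k + 1 ≤ K → ∀ pol x, appPol pol (s (k + 1)) x = α * appPol pol (s k) x
      + appPol pol (fun x a => r x a + γ * appP P (v k) x a + eps (k + 1) x a) x := by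
    intro k hk pol x
    rw [← appPol_const_mul, ← appPol_add]
    congr 1
    funext x a
    rw [hs (k + 1) k.succ_pos hk x a, Nat.add_sub_cancel]
    ring
  have hlower : ∀ k ≤ K, ∀ x, appPol (πs (k - 1))
      (propagatedQ γ r P πs eps qpi0 (k - 1) k) x ≤ v k x + γ ^ k * H := by
    intro k
    induction k with
    | zero =>
      intro _ x
      simpa [appPol_propagatedQ, bellmanComp, hv0] using (abs_le.1 (hq0 x)).2
    | succ k ih =>
      intro hk x
      have hk' : k ≤ K := Nat.le_of_succ_le hk
      have hstep := bellman_step_le hγ0 hPnn hPsum (hπs k hk') r (eps (k + 1)) (ih hk') x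
      have hsucc := funext₂ (propagatedQ_succ eps hqpi0 k k)
      have hge := hw_ge (k + 1) hk _ (hπs k hk') x
      rw [hs_pol k hk, hw_eq k hk'] at hge
      rw [hv (k + 1) k.succ_pos hk, Nat.add_sub_cancel, hsucc, pow_succ']
      simp only [Ppol]
      linarith
  have hupper : ∀ k ≤ K, ∀ x, v k x
      ≤ appPol (πs k) (propagatedQ γ r P πs eps qpi0 k k) x + γ ^ k * H := by
    intro k
    induction k with
    | zero =>
      intro _ x
      have := (abs_le.1 (hq0 x)).1
      simp only [appPol_propagatedQ, hv0, Pi.zero_apply, range_zero, sum_empty, pow_zero]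
      change 0 ≤ appPol (πs 0) qpi0 x + 0 + 1 * H
      linarith
    | succ k ih =>
      intro hk x
      have hk' : k ≤ K := Nat.le_of_succ_le hk
      have hstep := bellman_step_le hγ0 hPnn hPsum (hπs (k + 1) hk) r (eps (k + 1)) (ih hk') x
      have hsucc := funext₂ (propagatedQ_succ eps hqpi0 (k + 1) k)
      have hle := mul_le_mul_of_nonneg_left (hw_ge k hk' _ (hπs (k + 1) hk) x) hα0
      rw [hv (k + 1) k.succ_pos hk, ← hw_eq (k + 1) hk, hs_pol k hk, Nat.add_sub_cancel, hsucc,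
        pow_succ']
      simp only [Ppol, Nat.add_sub_cancel]
      linarith
  intro k _ hk x
  have hl := hlower k hk x
  have hu := hupper k hk x
  rw [appPol_propagatedQ] at hl hu
  exact ⟨sub_le_iff_le_add.2 hl, hu⟩
end
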